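/- arXiv:1109.3556 — 2 statements merged into one kernel-verified Lean document; each statement's English description precedes it below -/
import Mathlib

section
/- Let n = 2^k for some k ≥ 1. Then the path graph of length n is observable from every single node: for every i ∈ {1,...,n}, the only x ∈ ℝ^n satisfying (L_n^k x)_i = 0 for all k ∈ ℕ is x = 0. -/
/-- The Laplacian `L_n` of the path graph on `n` nodes. -/
noncomputable def Lpath (n : ℕ) : Matrix (Fin n) (Fin n) ℝ :=
  Matrix.of fun i j =>
    if i = j then (if (i : ℕ) = 0 ∨ (i : ℕ) = n - 1 then 1 else 2)
    else if (i : ℕ) + 1 = (j : ℕ) ∨ (j : ℕ) + 1 = (i : ℕ) then -1 else 0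

/-- A function on `ℤ` that is even under reflection at both ends of `{0, …, n - 1}` and satisfies
the recurrence `f (a - 1) + f (a + 1) = (2 - μ) f a` restricts to an eigenvector of `Lpath n`. -/
theorem Lpath_mulVec_eq_smul {n : ℕ} (hn : 2 ≤ n) (f : ℤ → ℝ) (μ : ℝ)
    (hrec : ∀ a, f (a - 1) + f (a + 1) = (2 - μ) * f a)
    (h0 : f (-1) = f 0) (h1 : f n = f (n - 1)) :
    (Lpath n).mulVec (fun j => f (j : ℕ)) = μ • fun j : Fin n => f (j : ℕ) := by
  ext i
  have key : ∀ j : Fin n, Lpath n i j * f (j : ℕ) =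
      (if (j : ℕ) = i then
        (if (i : ℕ) = 0 ∨ (i : ℕ) = n - 1 then 1 else 2) * f (i : ℕ) else 0)
      - (if (j : ℕ) = i + 1 then f ((i : ℕ) + 1) else 0)
      - (if (j : ℕ) + 1 = i then f ((i : ℕ) - 1) else 0) := by
    intro j
    simp only [Lpath, Matrix.of_apply, Fin.ext_iff]
    rcases lt_trichotomy (j : ℕ) i with h | h | h
    · by_cases h' : (j : ℕ) + 1 = i
      · have e : ((j : ℕ) : ℤ) = (i : ℕ) - 1 := by omega
        have e1 : ¬ (i : ℕ) = j := by omega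
        have e2 : ¬ (j : ℕ) = i := by omega
        have e3 : ¬ (j : ℕ) = i + 1 := by omega
        rw [if_neg e1, if_neg e2, if_neg e3, if_pos (Or.inr h'), if_pos h', e]
        ring
      · have e1 : ¬ (i : ℕ) = j := by omega
        have e2 : ¬ (j : ℕ) = i := by omega
        have e3 : ¬ (j : ℕ) = i + 1 := by omega
        have e4 : ¬ ((i : ℕ) + 1 = j ∨ (j : ℕ) + 1 = i) := by omega
        rw [if_neg e1, if_neg e2, if_neg e3, if_neg e4, if_neg h']
        ring
    · have e3 : ¬ (j : ℕ) = i + 1 := by omega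
      have e4 : ¬ (j : ℕ) + 1 = i := by omega
      rw [if_pos h.symm, if_pos h, if_neg e3, if_neg e4, h]
      ring
    · by_cases h' : (j : ℕ) = i + 1
      · have e : ((j : ℕ) : ℤ) = (i : ℕ) + 1 := by omega
        have e1 : ¬ (i : ℕ) = j := by omega
        have e2 : ¬ (j : ℕ) = i := by omega
        have e3 : ¬ (j : ℕ) + 1 = i := by omega
        rw [if_neg e1, if_neg e2, if_neg e3, if_pos (Or.inl h'.symm), if_pos h', e]
        ring
      · have e1 : ¬ (i : ℕ) = j := by omega
        have e2 : ¬ (j : ℕ) = i := by omega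
        have e3 : ¬ (j : ℕ) + 1 = i := by omega
        have e4 : ¬ ((i : ℕ) + 1 = j ∨ (j : ℕ) + 1 = i) := by omega
        rw [if_neg e1, if_neg e2, if_neg e3, if_neg e4, if_neg h']
        ring
  have hsum : ∀ (m : ℕ) (c : ℝ),
      ∑ j : Fin n, (if (j : ℕ) = m then c else 0) = if m < n then c else 0 := by
    intro m c
    rw [Fin.sum_univ_eq_sum_range (fun j => if j = m then c else 0) n]
    simp
  have hsum' : ∑ j : Fin n, (if (j : ℕ) + 1 = i then f ((i : ℕ) - 1) else 0) =
      if (i : ℕ) = 0 then 0 else f ((i : ℕ) - 1) := by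
    by_cases hi : (i : ℕ) = 0
    · simp [hi]
    · have e : ∀ j : Fin n, ((j : ℕ) + 1 = i) = ((j : ℕ) = i - 1) := by
        intro j; apply propext; omega
      simp only [e, hsum]
      rw [if_pos (by omega), if_neg hi]
  simp only [Matrix.mulVec, dotProduct, key, Finset.sum_sub_distrib, hsum, hsum', Pi.smul_apply,
    smul_eq_mul, if_pos i.2]
  have hr := hrec (i : ℕ)
  by_cases hi0 : (i : ℕ) = 0
  · rw [if_pos (Or.inl hi0), if_pos (by omega), if_pos hi0]
    rw [hi0] at hr ⊢
    simp only [Nat.cast_zero, zero_sub, h0] at hr ⊢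
    linarith
  · by_cases hi1 : (i : ℕ) = n - 1
    · have e : ((i : ℕ) : ℤ) + 1 = n := by omega
      have e' : ((n : ℤ) - 1) = (i : ℕ) := by omega
      rw [if_pos (Or.inr hi1), if_neg (by omega), if_neg hi0]
      rw [e, h1, e'] at hr
      linarith
    · rw [if_neg (by tauto), if_pos (by omega), if_neg hi0]
      linarith

/-- The discrete cosine vectors are eigenvectors of the path Laplacian. -/
theorem Lpath_mulVec_cos {n : ℕ} (hn : 2 ≤ n) (m : ℕ) :
    (Lpath n).mulVec (fun j => Real.cos (Real.pi * m / n * ((j : ℕ) + 1 / 2))) =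
      (2 - 2 * Real.cos (Real.pi * m / n)) •
        fun j : Fin n => Real.cos (Real.pi * m / n * ((j : ℕ) + 1 / 2)) := by
  have hn0 : (n : ℝ) ≠ 0 := by positivity
  have h := Lpath_mulVec_eq_smul hn (fun a : ℤ => Real.cos (Real.pi * m / n * ((a : ℝ) + 1 / 2)))
    (2 - 2 * Real.cos (Real.pi * m / n)) ?_ ?_ ?_
  · simpa only [Int.cast_natCast] using h
  · intro a
    have e1 : Real.pi * m / n * (((a - 1 : ℤ) : ℝ) + 1 / 2) =
      Real.pi * m / n * ((a : ℝ) + 1 / 2) - Real.pi * m / n := by push_cast; ring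
    have e2 : Real.pi * m / n * (((a + 1 : ℤ) : ℝ) + 1 / 2) =
      Real.pi * m / n * ((a : ℝ) + 1 / 2) + Real.pi * m / n := by push_cast; ring
    simp only [e1, e2, Real.cos_sub, Real.cos_add]
    ring
  · have e : Real.pi * m / n * (((-1 : ℤ) : ℝ) + 1 / 2) =
      -(Real.pi * m / n * (((0 : ℤ) : ℝ) + 1 / 2)) := by push_cast; ring
    simp only [e, Real.cos_neg]
  · have e1 : Real.pi * m / n * (((n : ℤ) : ℝ) + 1 / 2) =
      m * Real.pi + Real.pi * m / n / 2 := by push_cast; field_simp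
    have e2 : Real.pi * m / n * (((n - 1 : ℤ) : ℝ) + 1 / 2) =
      m * Real.pi - Real.pi * m / n / 2 := by push_cast; field_simp; ring
    simp only [e1, e2, Real.cos_sub, Real.cos_add, Real.sin_nat_mul_pi]
    ring

/-- The numbers `2 - 2 cos (π m / n)`, `0 ≤ m < n`, are distinct. -/
theorem injective_two_sub_two_mul_cos (n : ℕ) :
    Function.Injective fun m : Fin n => 2 - 2 * Real.cos (Real.pi * (m : ℕ) / n) := by
  intro a b hab
  have hn : (0 : ℝ) < n := by exact_mod_cast a.pos
  have hmem : ∀ m : Fin n, Real.pi * (m : ℕ) / n ∈ Set.Icc 0 Real.pi := by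
    intro m
    have hm : ((m : ℕ) : ℝ) ≤ n := by exact_mod_cast m.2.le
    refine ⟨by positivity, ?_⟩
    rw [div_le_iff₀ hn]
    exact mul_le_mul_of_nonneg_left hm Real.pi_pos.le
  have h := Real.injOn_cos (hmem a) (hmem b) (by simp only at hab; linarith)
  rw [div_left_inj' hn.ne'] at h
  have h' := mul_left_cancel₀ Real.pi_ne_zero h
  exact Fin.ext (by exact_mod_cast h')

/-- When `n` is a power of two, no discrete cosine vector has a zero entry. -/
theorem cos_pi_mul_div_two_pow_ne_zero (k m j : ℕ) (hm : m < 2 ^ k) :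
    Real.cos (Real.pi * m / (2 ^ k : ℕ) * ((j : ℝ) + 1 / 2)) ≠ 0 := by
  rw [Real.cos_ne_zero_iff]
  intro l h
  have h2 : ((2 ^ k : ℕ) : ℝ) ≠ 0 := by positivity
  have hpi := Real.pi_ne_zero
  have e : (m : ℝ) * (2 * j + 1) = (2 * l + 1) * (2 ^ k : ℕ) := by
    field_simp at h
    linarith
  have e' : (m : ℤ) * (2 * j + 1) = (2 * l + 1) * (2 ^ k : ℕ) := by exact_mod_cast e
  have hdvd : (2 ^ k : ℕ) ∣ m * (2 * j + 1) := by
    have : ((2 ^ k : ℕ) : ℤ) ∣ ((m * (2 * j + 1) : ℕ) : ℤ) :=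
      ⟨2 * l + 1, by push_cast at e' ⊢; linarith⟩
    exact_mod_cast this
  have hcop : Nat.Coprime (2 ^ k) (2 * j + 1) :=
    Nat.Coprime.pow_left k (by simp)
  have hm0 : m = 0 := Nat.eq_zero_of_dvd_of_lt (hcop.dvd_of_dvd_mul_right hdvd) hm
  subst hm0
  have hpos : ((2 ^ k : ℕ) : ℤ) ≠ 0 := by positivity
  rw [Nat.cast_zero, zero_mul, eq_comm, mul_eq_zero] at e'
  rcases e' with h' | h'
  · omega
  · exact hpos h'

/-- A matrix with `n` distinct eigenvalues is observable from any node at which no eigenvector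
vanishes. -/
theorem eq_zero_of_forall_pow_mulVec_apply_eq_zero {n : ℕ} {A : Matrix (Fin n) (Fin n) ℝ}
    {μ : Fin n → ℝ} {v : Fin n → Fin n → ℝ} (hμ : Function.Injective μ)
    (hA : ∀ m, A.mulVec (v m) = μ m • v m) {i : Fin n} (hv : ∀ m, v m i ≠ 0)
    {x : Fin n → ℝ} (hx : ∀ p : ℕ, (A ^ p).mulVec x i = 0) : x = 0 := by
  have hli : LinearIndependent ℝ v := by
    refine Module.End.eigenvectors_linearIndependent' (Matrix.toLin' A) μ hμ v fun m => ?_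
    refine ⟨Module.End.mem_eigenspace_iff.2 (by rw [Matrix.toLin'_apply, hA]), fun h => hv m ?_⟩
    rw [h, Pi.zero_apply]
  have hspan := hli.span_eq_top_of_card_eq_finrank' (by simp)
  obtain ⟨c, rfl⟩ := (Submodule.mem_span_range_iff_exists_fun ℝ).1
    (hspan ▸ Submodule.mem_top : x ∈ Submodule.span ℝ (Set.range v))
  have hpow : ∀ (p : ℕ) m, (A ^ p).mulVec (v m) = μ m ^ p • v m := by
    intro p m
    induction p with
    | zero => simp
    | succ p ih =>
      rw [pow_succ, ← Matrix.mulVec_mulVec, hA, Matrix.mulVec_smul, ih, smul_smul, pow_succ']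
  have hzero : (fun m => c m * v m i) = 0 := by
    refine Matrix.eq_zero_of_forall_pow_sum_mul_pow_eq_zero hμ fun p => ?_
    rw [← hx p, Matrix.mulVec_sum, Finset.sum_apply]
    refine Finset.sum_congr rfl fun m _ => ?_
    rw [Matrix.mulVec_smul, hpow]
    simp only [Pi.smul_apply, smul_eq_mul]
    ring
  refine Finset.sum_eq_zero fun m _ => ?_
  have hc : c m = 0 := (mul_eq_zero.1 (congrFun hzero m)).resolve_right (hv m)
  rw [hc, zero_smul]

/-- A path of length `n = 2^k` is observable from every single node. -/
theorem stmt14 (k : ℕ) (hk : 1 ≤ k) (n : ℕ) (hn : n = 2 ^ k) (i : Fin n)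
    (x : Fin n → ℝ) (hx : ∀ k' : ℕ, ((Lpath n) ^ k').mulVec x i = 0) :
    x = 0 := by
  subst hn
  have h2 : 2 ≤ 2 ^ k := Nat.le_self_pow (by omega) 2
  exact eq_zero_of_forall_pow_mulVec_apply_eq_zero (injective_two_sub_two_mul_cos (2 ^ k))
    (fun m => Lpath_mulVec_cos h2 m) (fun m => cos_pi_mul_div_two_pow_ne_zero k m i m.2) hx
end

section
/- Let n be odd with n ≥ 3. Then the path graph of length n is not observable from its central node i = (n+1)/2: there exists a nonzero x ∈ ℝ^n with (L_n^k x)_{(n+1)/2} = 0 for all k ∈ ℕ. Moreover, every eigenvalue of N_{(n−1)/2} is an eigenvalue λ of L_n admitting an eigenvector of the form V = (v, 0, −Πv), where v ∈ ℝ^{(n−1)/2} is an eigenvector of N_{(n−1)/2} for λ and Πv denotes v with its components in reversed order. -/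
/-- The matrix `N_ν`: symmetric tridiagonal with first diagonal entry 1,
remaining diagonal entries 2, and off-diagonal entries -1. -/
noncomputable def Nmat (ν : ℕ) : Matrix (Fin ν) (Fin ν) ℝ :=
  Matrix.of fun i j =>
    if i = j then (if (i : ℕ) = 0 then 1 else 2)
    else if (i : ℕ) + 1 = (j : ℕ) ∨ (j : ℕ) + 1 = (i : ℕ) then -1 else 0

/-- The action of a row of a tridiagonal matrix with off-diagonal entries `-1`. -/
theorem sum_tridiagonal_row (n : ℕ) (i : Fin n) (d : ℝ) (f : ℕ → ℝ) :
    ∑ j : Fin n, (if i = j then d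
      else if (i : ℕ) + 1 = (j : ℕ) ∨ (j : ℕ) + 1 = (i : ℕ) then -1 else 0) * f j =
    d * f i - (if (i : ℕ) + 1 < n then f (i + 1) else 0)
      - (if (i : ℕ) = 0 then 0 else f (i - 1)) := by
  obtain ⟨i, hi⟩ := i
  simp only [Fin.ext_iff]
  rw [Fin.sum_univ_eq_sum_range (fun j => (if i = j then d
      else if i + 1 = j ∨ j + 1 = i then -1 else 0) * f j) n]
  have key : ∀ j ∈ Finset.range n,
      (if i = j then d else if i + 1 = j ∨ j + 1 = i then -1 else 0) * f j =
        (if i = j then d * f j else 0) - (if i + 1 = j then f j else 0)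
          - (if i - 1 = j then (if i = 0 then 0 else f j) else 0) := by
    intro j _
    split_ifs <;> first | omega | ring
  rw [Finset.sum_congr rfl key, Finset.sum_sub_distrib, Finset.sum_sub_distrib]
  simp only [Finset.sum_ite_eq, Finset.mem_range, hi, if_true, show i - 1 < n by omega]

theorem Lpath_mulVec_apply (n : ℕ) (f : ℕ → ℝ) (i : Fin n) :
    (Lpath n).mulVec (fun j => f j) i =
      (if (i : ℕ) = 0 ∨ (i : ℕ) = n - 1 then 1 else 2) * f i
        - (if (i : ℕ) + 1 < n then f (i + 1) else 0)
        - (if (i : ℕ) = 0 then 0 else f (i - 1)) :=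
  sum_tridiagonal_row n i _ f

theorem Nmat_mulVec_apply (ν : ℕ) (f : ℕ → ℝ) (i : Fin ν) :
    (Nmat ν).mulVec (fun j => f j) i =
      (if (i : ℕ) = 0 then 1 else 2) * f i
        - (if (i : ℕ) + 1 < ν then f (i + 1) else 0)
        - (if (i : ℕ) = 0 then 0 else f (i - 1)) :=
  sum_tridiagonal_row ν i _ f

theorem Lpath_rev_rev (n : ℕ) (i j : Fin n) : Lpath n i.rev j.rev = Lpath n i j := by
  have := i.isLt
  have := j.isLt
  simp only [Lpath, Matrix.of_apply, Fin.ext_iff, Fin.val_rev]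
  split_ifs <;> first | rfl | omega

/-- The powers of the path Laplacian preserve vectors that are antisymmetric under reversal. -/
theorem Lpath_pow_mulVec_rev (n : ℕ) (x : Fin n → ℝ) (hx : ∀ i, x i.rev = -x i) (k : ℕ)
    (i : Fin n) : ((Lpath n) ^ k).mulVec x i.rev = -((Lpath n) ^ k).mulVec x i := by
  induction k generalizing i with
  | zero => simpa using hx i
  | succ k ih =>
    rw [pow_succ', ← Matrix.mulVec_mulVec]
    simp only [Matrix.mulVec, dotProduct] at ih ⊢
    rw [← Equiv.sum_comp Fin.revPerm, ← Finset.sum_neg_distrib]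
    refine Finset.sum_congr rfl fun j _ => ?_
    rw [Fin.revPerm_apply, Lpath_rev_rev, ih, mul_neg]

/-- A path with an odd number `n` of nodes is not observable from its central
node `(n+1)/2`; moreover every eigenvalue `λ` of `N_{(n−1)/2}` (with eigenvector
`v`) is an eigenvalue of `L_n` with eigenvector `V = (v, 0, −Πv)`, where `Πv`
is `v` with components reversed. (A node with label `i ∈ {1,...,n}` corresponds
to the index `i-1 : Fin n`.) -/
theorem stmt15 (n : ℕ) (hn : 3 ≤ n) (hodd : n % 2 = 1) :
    (∃ x : Fin n → ℝ, x ≠ 0 ∧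
        ∀ k : ℕ, ((Lpath n) ^ k).mulVec x ⟨(n + 1) / 2 - 1, by omega⟩ = 0) ∧
    (∀ (lam : ℝ) (v : Fin ((n - 1) / 2) → ℝ), v ≠ 0 →
      (Nmat ((n - 1) / 2)).mulVec v = lam • v →
      ∀ V : Fin n → ℝ,
        (V = fun j : Fin n =>
          if h : (j : ℕ) < (n - 1) / 2 then v ⟨(j : ℕ), h⟩
          else if h2 : (j : ℕ) = (n - 1) / 2 then 0
          else -v ⟨n - 1 - (j : ℕ), by have := j.isLt; omega⟩) →
        V ≠ 0 ∧ (Lpath n).mulVec V = lam • V) := by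
  obtain ⟨m, rfl⟩ : ∃ m, n = 2 * m + 1 := ⟨n / 2, by omega⟩
  refine ⟨⟨fun i => (i : ℝ) - m, ?_, fun k => ?_⟩, ?_⟩
  · intro h
    have h0 := congrFun h ⟨0, by omega⟩
    have hm : m ≠ 0 := by omega
    simp [hm] at h0
  · have h := Lpath_pow_mulVec_rev (2 * m + 1) (fun i => (i : ℝ) - m) (fun i => ?_) k
      ⟨(2 * m + 1 + 1) / 2 - 1, by omega⟩
    · rw [show Fin.rev (⟨(2 * m + 1 + 1) / 2 - 1, by omega⟩ : Fin (2 * m + 1)) =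
        ⟨(2 * m + 1 + 1) / 2 - 1, by omega⟩ by ext; simp only [Fin.val_rev]; omega] at h
      linarith
    · have hi : (i.rev : ℕ) + i = 2 * m := by rw [Fin.val_rev]; omega
      have hi' : ((i.rev : ℕ) : ℝ) + i = 2 * m := by exact_mod_cast hi
      linarith
  · intro lam v hv hN V hV
    generalize hg : (fun j : ℕ => if h : j < (2 * m + 1 - 1) / 2 then v ⟨j, h⟩ else 0) = g
    have hgv : ∀ (j : ℕ) (h : j < (2 * m + 1 - 1) / 2), g j = v ⟨j, h⟩ := by
      intro j h
      rw [← hg]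
      exact dif_pos h
    have hg0 : ∀ j, m ≤ j → g j = 0 := by
      intro j h
      simp only [← hg]
      rw [dif_neg (by omega)]
    have hvg : v = fun j : Fin ((2 * m + 1 - 1) / 2) => g j := funext fun j => (hgv j j.isLt).symm
    have hrow : ∀ i < m, (if i = 0 then 1 else 2) * g i - g (i + 1)
        - (if i = 0 then 0 else g (i - 1)) = lam * g i := by
      intro i hi
      have h := congrFun hN ⟨i, by omega⟩
      rw [hvg, Nmat_mulVec_apply _ g] at h
      simp only [Pi.smul_apply, smul_eq_mul] at h
      rw [← h]
      congr 2
      split_ifs with h1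
      · rfl
      · exact hg0 _ (by omega)
    have hVg : V = fun j : Fin (2 * m + 1) =>
        (fun j : ℕ => g j - g (2 * m - j)) j := by
      rw [hV]
      funext j
      have := j.isLt
      dsimp only
      split_ifs with h1 h2
      · rw [hgv _ h1, hg0 (2 * m - j) (by omega), sub_zero]
      · rw [hg0 j (by omega), hg0 (2 * m - j) (by omega), sub_zero]
      · rw [hg0 j (by omega), hgv (2 * m - j) (by omega), zero_sub]
        rfl
    refine ⟨fun h => hv ?_, ?_⟩
    · funext j
      have hj := congrFun h ⟨j, by omega⟩
      simp only [hV] at hj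
      rwa [dif_pos j.isLt] at hj
    · funext ⟨i, hi⟩
      rw [hVg]
      refine (Lpath_mulVec_apply _ (fun j => g j - g (2 * m - j)) _).trans ?_
      simp only [Pi.smul_apply, smul_eq_mul]
      rcases lt_trichotomy i m with h | rfl | h
      · rw [hg0 (2 * m - i) (by omega), hg0 (2 * m - (i + 1)) (by omega),
          hg0 (2 * m - (i - 1)) (by omega), if_pos (show i + 1 < 2 * m + 1 by omega)]
        have := hrow i h
        have h2 : i ≠ 2 * m + 1 - 1 := by omega
        simp only [h2, or_false, sub_zero]
        exact this
      · rw [if_pos (show i + 1 < 2 * i + 1 by omega), if_neg (show i ≠ 0 by omega),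
          hg0 (i + 1) (by omega), hg0 (2 * i - (i - 1)) (by omega),
          show 2 * i - i = i by omega, show 2 * i - (i + 1) = i - 1 by omega]
        ring
      · obtain ⟨p, hp⟩ : ∃ p, p + i = 2 * m := ⟨2 * m - i, by omega⟩
        have := hrow p (by omega)
        rw [if_neg (show i ≠ 0 by omega), hg0 i (by omega), hg0 (i + 1) (by omega),
          hg0 (i - 1) (by omega), show 2 * m - i = p by omega,
          show 2 * m - (i + 1) = p - 1 by omega, show 2 * m - (i - 1) = p + 1 by omega]
        by_cases hp0 : p = 0
        · rw [if_pos (show i = 0 ∨ i = 2 * m + 1 - 1 by omega),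
            if_neg (show ¬ i + 1 < 2 * m + 1 by omega)]
          simp only [hp0, if_true] at this ⊢
          linarith
        · rw [if_neg (show ¬ (i = 0 ∨ i = 2 * m + 1 - 1) by omega),
            if_pos (show i + 1 < 2 * m + 1 by omega)]
          simp only [hp0, if_false] at this ⊢
          linarith
end
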